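/- Fix M ≥ 1. There exist constants c, C > 0, depending only on M, such that whenever s, t > 0 satisfy η(s) = M·η(t): if 0 < t ≤ 1 then c·t^{1/M} ≤ s ≤ C·t^{1/M}, and if t ≥ 1 then c·t ≤ s ≤ C·t. -/

import Mathlib

open Real

/-- The complete elliptic integral of the first kind. -/
noncomputable def ellipticK (k : ℝ) : ℝ :=
  ∫ θ in (0 : ℝ)..(π / 2), 1 / Real.sqrt (1 - k ^ 2 * Real.sin θ ^ 2)

/-- The modulus function `η(t) = K(√(1 - e^{-t})) / K(e^{-t/2})`. -/
noncomputable def boxModulus (t : ℝ) : ℝ :=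
  ellipticK (Real.sqrt (1 - Real.exp (-t))) / ellipticK (Real.exp (-t / 2))

lemma ellipticK_eq_integral_cos (k : ℝ) :
    ellipticK k = ∫ φ in (0 : ℝ)..(π / 2), 1 / √(1 - k ^ 2 * cos φ ^ 2) := by
  have h := intervalIntegral.integral_comp_sub_left (a := 0) (b := π / 2)
    (fun θ : ℝ => 1 / √(1 - k ^ 2 * sin θ ^ 2)) (π / 2)
  simp only [sin_pi_div_two_sub, sub_self, sub_zero] at h
  exact h.symm

lemma one_sub_sq_mul_cos_sq {k b : ℝ} (h : k ^ 2 + b ^ 2 = 1) (φ : ℝ) :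
    1 - k ^ 2 * cos φ ^ 2 = b ^ 2 + k ^ 2 * sin φ ^ 2 := by
  linear_combination -h - k ^ 2 * sin_sq_add_cos_sq φ

lemma continuous_ellipticK_integrand {k b : ℝ} (hb : 0 < b) (h : k ^ 2 + b ^ 2 = 1) :
    Continuous fun φ : ℝ => 1 / √(1 - k ^ 2 * cos φ ^ 2) := by
  refine continuous_const.div (by fun_prop) fun φ => ?_
  rw [one_sub_sq_mul_cos_sq h]
  positivity

lemma ellipticK_integrand_le_inv {k b : ℝ} (hb : 0 < b) (h : k ^ 2 + b ^ 2 = 1) (φ : ℝ) :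
    1 / √(1 - k ^ 2 * cos φ ^ 2) ≤ 1 / b := by
  rw [one_sub_sq_mul_cos_sq h]
  refine one_div_le_one_div_of_le hb (Real.le_sqrt_of_sq_le ?_)
  nlinarith [mul_nonneg (sq_nonneg k) (sq_nonneg (sin φ))]

lemma ellipticK_le_pi_div {k b : ℝ} (hb : 0 < b) (h : k ^ 2 + b ^ 2 = 1) :
    ellipticK k ≤ π / 2 / b := by
  rw [ellipticK_eq_integral_cos]
  calc _ ≤ ∫ _ in (0 : ℝ)..(π / 2), 1 / b :=
        intervalIntegral.integral_mono_on (by positivity)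
          ((continuous_ellipticK_integrand hb h).intervalIntegrable _ _) (by simp)
          fun φ _ => ellipticK_integrand_le_inv hb h φ
    _ = π / 2 / b := by rw [intervalIntegral.integral_const]; simp [div_eq_mul_inv]

lemma pi_div_two_le_ellipticK {k b : ℝ} (hb : 0 < b) (h : k ^ 2 + b ^ 2 = 1) :
    π / 2 ≤ ellipticK k := by
  rw [ellipticK_eq_integral_cos]
  calc π / 2 = ∫ _ in (0 : ℝ)..(π / 2), (1 : ℝ) := by simp
    _ ≤ _ := intervalIntegral.integral_mono_on (by positivity) (by simp)
          ((continuous_ellipticK_integrand hb h).intervalIntegrable _ _) fun φ _ => by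
            have h0 : 0 < 1 - k ^ 2 * cos φ ^ 2 := by
              rw [one_sub_sq_mul_cos_sq h]; positivity
            rw [le_div_iff₀ (sqrt_pos.2 h0), one_mul, Real.sqrt_le_one]
            nlinarith [mul_nonneg (sq_nonneg k) (sq_nonneg (cos φ))]

lemma log_inv_le_ellipticK {k b : ℝ} (hb : 0 < b) (h : k ^ 2 + b ^ 2 = 1) :
    log b⁻¹ ≤ ellipticK k := by
  rw [ellipticK_eq_integral_cos]
  have hpi := pi_gt_three
  have hpos : ∀ φ ∈ Set.Icc (0 : ℝ) (π / 2), 0 < b + φ := fun φ hφ => by linarith [hφ.1]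
  have hu : Set.uIcc (0 : ℝ) (π / 2) = Set.Icc 0 (π / 2) := Set.uIcc_of_le (by positivity)
  have hcont : ContinuousOn (fun φ : ℝ => 1 / (b + φ)) (Set.uIcc 0 (π / 2)) := by
    rw [hu]
    exact continuousOn_const.div (by fun_prop) fun φ hφ => (hpos φ hφ).ne'
  have hint : ∫ φ in (0 : ℝ)..(π / 2), 1 / (b + φ) = log (b + π / 2) - log (b + 0) := by
    refine intervalIntegral.integral_eq_sub_of_hasDerivAt (f := fun φ => log (b + φ))
      (fun φ hφ => ?_) hcont.intervalIntegrable
    rw [hu] at hφ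
    exact ((hasDerivAt_id φ).const_add b).log (hpos φ hφ).ne'
  calc log b⁻¹ ≤ log (b + π / 2) - log (b + 0) := by
        rw [log_inv, add_zero]
        linarith [log_nonneg (show (1 : ℝ) ≤ b + π / 2 by linarith)]
    _ = _ := hint.symm
    _ ≤ _ := intervalIntegral.integral_mono_on (by positivity) hcont.intervalIntegrable
          ((continuous_ellipticK_integrand hb h).intervalIntegrable _ _) fun φ hφ => by
            rw [one_sub_sq_mul_cos_sq h]
            refine one_div_le_one_div_of_le (by positivity) (Real.sqrt_le_iff.2
              ⟨(hpos φ hφ).le, ?_⟩)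
            have h1 : sin φ ^ 2 ≤ φ ^ 2 := sin_sq_le_sq
            nlinarith [mul_nonneg (sq_nonneg b) (sq_nonneg (sin φ)), mul_nonneg hb.le hφ.1]

lemma one_div_sin_le {φ : ℝ} (h0 : 0 < φ) (h1 : φ ≤ π / 2) : 1 / sin φ ≤ 1 / φ + 1 := by
  have hs : 0 < sin φ := sin_pos_of_pos_of_lt_pi h0 (by linarith [pi_pos])
  have key : φ ≤ (1 + φ) * sin φ := by
    rcases le_or_gt φ 1 with h | h
    · have := sin_gt_sub_cube h0
      nlinarith [mul_pos h0 h0, mul_pos (mul_pos h0 h0) h0,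
        mul_nonneg (mul_pos h0 h0).le (sub_nonneg.2 h),
        mul_nonneg (mul_pos (mul_pos h0 h0) h0).le (sub_nonneg.2 h)]
    · have h2 := mul_le_sin h0.le h1
      have h3 : 1 / 2 * φ ≤ 2 / π * φ := by
        refine mul_le_mul_of_nonneg_right ?_ h0.le
        rw [div_le_div_iff₀ (by norm_num) pi_pos]
        linarith [pi_le_four]
      nlinarith
  rw [div_add_one h0.ne', div_le_div_iff₀ hs h0]
  linarith

lemma ellipticK_le_log_inv {k b : ℝ} (hb : 0 < b) (h : k ^ 2 + b ^ 2 = 1) :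
    ellipticK k ≤ 4 + log b⁻¹ := by
  have hpi := pi_gt_three
  have hpi' := pi_lt_d2
  have hb1 : b ≤ 1 := by nlinarith [sq_nonneg k]
  have hbp : b ≤ π / 2 := by linarith
  have hi := continuous_ellipticK_integrand hb h
  rw [ellipticK_eq_integral_cos, ← intervalIntegral.integral_add_adjacent_intervals
    (hi.intervalIntegrable 0 b) (hi.intervalIntegrable b (π / 2))]
  have hfst : ∫ φ in (0 : ℝ)..b, 1 / √(1 - k ^ 2 * cos φ ^ 2) ≤ 1 := by
    calc _ ≤ ∫ _ in (0 : ℝ)..b, 1 / b :=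
          intervalIntegral.integral_mono_on hb.le (hi.intervalIntegrable _ _) (by simp)
            fun φ _ => ellipticK_integrand_le_inv hb h φ
      _ = 1 := by rw [intervalIntegral.integral_const]; simp [hb.ne']
  have hu : Set.uIcc b (π / 2) = Set.Icc b (π / 2) := Set.uIcc_of_le hbp
  have hpos : ∀ φ ∈ Set.Icc b (π / 2), 0 < φ := fun φ hφ => hb.trans_le hφ.1
  have hcont : ContinuousOn (fun φ : ℝ => 1 / φ + 1) (Set.uIcc b (π / 2)) := by
    rw [hu]
    exact (continuousOn_const.div continuousOn_id fun φ hφ => (hpos φ hφ).ne').add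
      continuousOn_const
  have hint : ∫ φ in b..(π / 2), (1 / φ + 1) = (log (π / 2) + π / 2) - (log b + b) := by
    refine intervalIntegral.integral_eq_sub_of_hasDerivAt (f := fun φ => log φ + φ)
      (fun φ hφ => ?_) hcont.intervalIntegrable
    rw [hu] at hφ
    rw [one_div]
    exact (hasDerivAt_log (hpos φ hφ).ne').add (hasDerivAt_id φ)
  have hsnd : ∫ φ in b..(π / 2), 1 / √(1 - k ^ 2 * cos φ ^ 2) ≤
      (log (π / 2) + π / 2) - (log b + b) := by
    rw [← hint]
    refine intervalIntegral.integral_mono_on hbp (hi.intervalIntegrable _ _)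
      hcont.intervalIntegrable fun φ hφ => le_trans ?_ (one_div_sin_le (hpos φ hφ) hφ.2)
    have hs : 0 < sin φ := sin_pos_of_pos_of_lt_pi (hpos φ hφ) (by linarith [hφ.2])
    refine one_div_le_one_div_of_le hs (Real.le_sqrt_of_sq_le ?_)
    have hk : k ^ 2 ≤ 1 := by nlinarith [sq_nonneg b]
    nlinarith [sin_sq_add_cos_sq φ, mul_nonneg (sub_nonneg.2 hk) (sq_nonneg (cos φ))]
  have hlog := log_le_sub_one_of_pos (show 0 < π / 2 by linarith)
  rw [log_inv]
  linarith

section Modulus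

variable {t : ℝ}

lemma sqrt_one_sub_exp_neg_pos (ht : 0 < t) : 0 < √(1 - exp (-t)) :=
  sqrt_pos.2 (by linarith [exp_lt_one_iff.2 (neg_lt_zero.2 ht)])

lemma sq_sqrt_one_sub_exp_neg_add (ht : 0 < t) :
    √(1 - exp (-t)) ^ 2 + exp (-t / 2) ^ 2 = 1 := by
  rw [sq_sqrt (by linarith [exp_lt_one_iff.2 (neg_lt_zero.2 ht)]), ← exp_nat_mul]
  ring_nf

lemma log_inv_exp_neg_half : log (exp (-t / 2))⁻¹ = t / 2 := by
  rw [log_inv, log_exp]; ring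

lemma half_neg_log_le_log_inv_sqrt (ht : 0 < t) :
    -log t / 2 ≤ log (√(1 - exp (-t)))⁻¹ := by
  have h0 : 0 < 1 - exp (-t) := by linarith [exp_lt_one_iff.2 (neg_lt_zero.2 ht)]
  rw [log_inv, log_sqrt h0.le]
  linarith [log_le_log h0 (show 1 - exp (-t) ≤ t by linarith [add_one_le_exp (-t)])]

lemma log_inv_sqrt_le (ht : 0 < t) :
    log (√(1 - exp (-t)))⁻¹ ≤ -log t / 2 + t / 2 := by
  have h0 : 0 < 1 - exp (-t) := by linarith [exp_lt_one_iff.2 (neg_lt_zero.2 ht)]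
  have h1 : t * exp (-t) ≤ 1 - exp (-t) := by
    have h2 : exp t * exp (-t) = 1 := by rw [← exp_add]; simp
    nlinarith [add_one_le_exp t, exp_pos (-t)]
  have h3 := log_le_log (by positivity) h1
  rw [log_mul ht.ne' (exp_pos _).ne', log_exp] at h3
  rw [log_inv, log_sqrt h0.le]
  linarith

lemma pi_div_two_le_numerator (ht : 0 < t) : π / 2 ≤ ellipticK √(1 - exp (-t)) :=
  pi_div_two_le_ellipticK (exp_pos _) (sq_sqrt_one_sub_exp_neg_add ht)

lemma half_le_numerator (ht : 0 < t) : t / 2 ≤ ellipticK √(1 - exp (-t)) :=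
  log_inv_exp_neg_half.symm.trans_le
    (log_inv_le_ellipticK (exp_pos _) (sq_sqrt_one_sub_exp_neg_add ht))

lemma numerator_le (ht : 0 < t) : ellipticK √(1 - exp (-t)) ≤ 4 + t / 2 :=
  (ellipticK_le_log_inv (exp_pos _) (sq_sqrt_one_sub_exp_neg_add ht)).trans_eq
    (by rw [log_inv_exp_neg_half])

lemma pi_div_two_le_denominator (ht : 0 < t) : π / 2 ≤ ellipticK (exp (-t / 2)) :=
  pi_div_two_le_ellipticK (sqrt_one_sub_exp_neg_pos ht)
    ((add_comm _ _).trans (sq_sqrt_one_sub_exp_neg_add ht))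

lemma denominator_le_pi (ht : 1 ≤ t) : ellipticK (exp (-t / 2)) ≤ π := by
  have ht0 : 0 < t := by linarith
  refine (ellipticK_le_pi_div (sqrt_one_sub_exp_neg_pos ht0)
    ((add_comm _ _).trans (sq_sqrt_one_sub_exp_neg_add ht0))).trans ?_
  have h1 : (1 / 2 : ℝ) ≤ √(1 - exp (-t)) := by
    refine Real.le_sqrt_of_sq_le ?_
    have h2 : exp t * exp (-t) = 1 := by rw [← exp_add]; simp
    nlinarith [add_one_le_exp t, exp_pos (-t)]
  rw [div_le_iff₀ (by linarith)]
  nlinarith [pi_pos]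

lemma boxModulus_pos (ht : 0 < t) : 0 < boxModulus t :=
  div_pos ((half_pos pi_pos).trans_le (pi_div_two_le_numerator ht))
    ((half_pos pi_pos).trans_le (pi_div_two_le_denominator ht))

lemma boxModulus_le (ht : 0 < t) : boxModulus t ≤ (8 + t) / π := by
  have hd := pi_div_two_le_denominator ht
  calc boxModulus t ≤ (4 + t / 2) / (π / 2) :=
        div_le_div₀ (by positivity) (numerator_le ht) (half_pos pi_pos) hd
    _ = (8 + t) / π := by field_simp; ring

lemma div_two_pi_le_boxModulus (ht : 1 ≤ t) : t / (2 * π) ≤ boxModulus t := by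
  have ht0 : 0 < t := by linarith
  have hd := (half_pos pi_pos).trans_le (pi_div_two_le_denominator ht0)
  calc t / (2 * π) = (t / 2) / π := by field_simp
    _ ≤ boxModulus t :=
        div_le_div₀ ((half_pos ht0).le.trans (half_le_numerator ht0)) (half_le_numerator ht0)
          hd (denominator_le_pi ht)

lemma pi_div_boxModulus_le (ht : 0 < t) : π / boxModulus t ≤ -log t + t + 8 := by
  have hn := pi_div_two_le_numerator ht
  have hn0 := (half_pos pi_pos).trans_le hn
  have hd0 := (half_pos pi_pos).trans_le (pi_div_two_le_denominator ht)
  have hd : ellipticK (exp (-t / 2)) ≤ 4 + (-log t / 2 + t / 2) :=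
    (ellipticK_le_log_inv (sqrt_one_sub_exp_neg_pos ht)
      ((add_comm _ _).trans (sq_sqrt_one_sub_exp_neg_add ht))).trans
      (by linarith [log_inv_sqrt_le ht])
  rw [boxModulus, div_div_eq_mul_div, div_le_iff₀ hn0]
  nlinarith [pi_pos]

lemma neg_log_le_pi_div_boxModulus (ht : 0 < t) : -log t - 1 / 2 ≤ π / boxModulus t := by
  rcases le_or_gt 1 t with h1 | h1
  · have := div_pos pi_pos (boxModulus_pos ht)
    linarith [log_nonneg h1]
  have hn0 := (half_pos pi_pos).trans_le (pi_div_two_le_numerator ht)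
  have hn := ellipticK_le_pi_div (exp_pos _) (sq_sqrt_one_sub_exp_neg_add ht)
  have hd : -log t / 2 ≤ ellipticK (exp (-t / 2)) :=
    (half_neg_log_le_log_inv_sqrt ht).trans
      (log_inv_le_ellipticK (sqrt_one_sub_exp_neg_pos ht)
      ((add_comm _ _).trans (sq_sqrt_one_sub_exp_neg_add ht)))
  have hlog : log t < 0 := log_neg ht h1
  have hlog' : -log t * t ≤ 1 := by
    have h2 := one_sub_inv_le_log_of_pos ht
    have h3 : t⁻¹ * t = 1 := inv_mul_cancel₀ ht.ne'
    nlinarith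
  calc -log t - 1 / 2 ≤ -log t * (1 + -t / 2) := by nlinarith
    _ ≤ -log t * exp (-t / 2) := by
        have := add_one_le_exp (-t / 2)
        exact mul_le_mul_of_nonneg_left (by linarith) (by linarith)
    _ = π * (-log t / 2) / (π / 2 / exp (-t / 2)) := by
        field_simp
    _ ≤ π * ellipticK (exp (-t / 2)) / ellipticK √(1 - exp (-t)) :=
        div_le_div₀ (mul_nonneg pi_pos.le (le_trans (by linarith) hd))
          (mul_le_mul_of_nonneg_left hd pi_pos.le) hn0 hn
    _ = π / boxModulus t := by rw [boxModulus, div_div_eq_mul_div]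

end Modulus

/-- Fix `M ≥ 1`. There exist constants `c, C > 0`, depending only on `M`,
such that whenever `s, t > 0` satisfy `η s = M * η t`: if `0 < t ≤ 1` then
`c * t^(1/M) ≤ s ≤ C * t^(1/M)`, and if `t ≥ 1` then `c * t ≤ s ≤ C * t`. -/
theorem boxModulus_distortion_regimes (M : ℝ) (hM : 1 ≤ M) :
    ∃ c C : ℝ, 0 < c ∧ 0 < C ∧
      ∀ s t : ℝ, 0 < s → 0 < t → boxModulus s = M * boxModulus t →
        (t ≤ 1 → c * t ^ (1 / M) ≤ s ∧ s ≤ C * t ^ (1 / M)) ∧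
        (1 ≤ t → c * t ≤ s ∧ s ≤ C * t) := by
  have hM0 : 0 < M := by linarith
  refine ⟨exp (-10) / 18, exp (24 * M + 10), by positivity, exp_pos _, ?_⟩
  intro s t hs ht hst
  have hη := boxModulus_pos ht
  have hL : π / boxModulus t = M * (π / boxModulus s) := by
    rw [hst]; field_simp
  have hs_large : ∀ r, 0 < r → t ≤ r → 1 ≤ r → s ≤ 24 * M * r := by
    intro r hr htr h1r
    rcases le_or_gt 1 s with h1 | h1
    · have h2 := div_two_pi_le_boxModulus h1
      have h3 : boxModulus t ≤ 9 * r / π :=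
        (boxModulus_le ht).trans (div_le_div_of_nonneg_right (by linarith) pi_pos.le)
      have h4 : s / (2 * π) ≤ M * (9 * r / π) := by
        rw [hst] at h2
        exact h2.trans (mul_le_mul_of_nonneg_left h3 hM0.le)
      have h5 : M * (9 * r / π) = 18 * M * r / (2 * π) := by field_simp; ring
      rw [h5, div_le_div_iff_of_pos_right (by positivity)] at h4
      nlinarith [mul_pos hM0 hr]
    · nlinarith [mul_le_mul hM h1r zero_le_one hM0.le]
  have hlow := neg_log_le_pi_div_boxModulus hs
  constructor
  · intro ht1
    have hpow : t ^ (1 / M) = exp (log t / M) := by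
      rw [rpow_def_of_pos ht]; ring_nf
    have hs' : s = exp (log s) := (exp_log hs).symm
    constructor
    · have h1 := pi_div_boxModulus_le ht
      have h2 : log t / M ≤ log s + 10 := by
        rw [div_le_iff₀ hM0]
        nlinarith [mul_le_mul_of_nonneg_left hlow hM0.le]
      calc exp (-10) / 18 * t ^ (1 / M) ≤ exp (-10) * t ^ (1 / M) := by
            gcongr
            linarith [exp_pos (-10)]
        _ = exp (-10 + log t / M) := by rw [hpow, exp_add]
        _ ≤ exp (log s) := exp_le_exp.2 (by linarith)
        _ = s := exp_log hs
    · have hS := hs_large 1 one_pos ht1 le_rfl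
      have h1 := pi_div_boxModulus_le hs
      have h2 := neg_log_le_pi_div_boxModulus ht
      have h3 : log s - 24 * M - 10 ≤ log t / M := by
        rw [le_div_iff₀ hM0]
        nlinarith [mul_le_mul_of_nonneg_left h1 hM0.le, mul_le_mul_of_nonneg_left hS hM0.le]
      calc s = exp (log s) := hs'
        _ ≤ exp (24 * M + 10 + log t / M) := exp_le_exp.2 (by linarith)
        _ = _ := by rw [hpow, exp_add]
  · intro ht1
    constructor
    · have he : exp (-10) ≤ 1 := exp_le_one_iff.2 (by norm_num)
      have h2 : t / (2 * π) ≤ (8 + s) / π :=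
        calc t / (2 * π) ≤ boxModulus t := div_two_pi_le_boxModulus ht1
          _ ≤ boxModulus s := by rw [hst]; nlinarith
          _ ≤ _ := boxModulus_le hs
      rw [div_le_div_iff₀ (by positivity) pi_pos] at h2
      have h3 : t ≤ 16 + 2 * s := by nlinarith [pi_pos]
      rcases le_or_gt 1 s with h1 | h1
      · nlinarith [exp_pos (-10)]
      · have hL2 : π / boxModulus t ≤ 9 := by
          have h4 : 1 / 2 ≤ boxModulus t := by
            refine le_trans ?_ (div_le_div₀ (a := π / 2) (b := π)
              ((half_pos pi_pos).le.trans (pi_div_two_le_numerator ht))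
              (pi_div_two_le_numerator ht)
              ((half_pos pi_pos).trans_le (pi_div_two_le_denominator ht))
              (denominator_le_pi ht1))
            rw [div_le_div_iff₀ (by norm_num) pi_pos]
            linarith
          rw [div_le_iff₀ hη]
          linarith [pi_le_four]
        have hLs : π / boxModulus s ≤ 9 := by
          have := div_pos pi_pos (boxModulus_pos hs)
          nlinarith
        have h5 : exp (-10) ≤ s := by
          rw [← le_log_iff_exp_le hs]
          linarith
        nlinarith [exp_pos (-10)]
    · refine (hs_large t ht le_rfl ht1).trans (mul_le_mul_of_nonneg_right ?_ ht.le)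
      linarith [add_one_le_exp (24 * M + 10)]
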